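/- Suppose the algebraic type has at most countably many function symbols and let L be a logic over it. If the Leibniz operator Ω is order-reflecting on Th L, then for every algebra A the Leibniz operator Ω^A is order-reflecting on Fi_L A; and if Ω is order-reflecting on Th L ∖ {∅}, then for every algebra A the Leibniz operator Ω^A is order-reflecting on Fi_L A ∖ {∅}. (For logics in a countable language, the (almost) order-reflection of the Leibniz operator transfers from theories to filters over arbitrary algebras.) -/

import Mathlib

universe u

/-- An algebraic type (signature): a set of function symbols with finite arities. -/
structure AlgSig : Type (u + 1) where
  F : Type u
  ar : F → ℕ

/-- Terms (formulas) over a signature, with a countably infinite set `ℕ` of variables. -/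
inductive Trm (S : AlgSig.{u}) : Type u
  | var : ℕ → Trm S
  | app : (f : S.F) → (Fin (S.ar f) → Trm S) → Trm S

/-- An algebra of a given signature. -/
structure AlgStr (S : AlgSig.{u}) : Type (u + 1) where
  α : Type u
  op : (f : S.F) → (Fin (S.ar f) → α) → α

variable {S : AlgSig.{u}}

/-- Evaluation of a term in an algebra under a valuation (equivalently, the unique
homomorphism from the term algebra determined by the valuation). -/
def Trm.eval (A : AlgStr S) (v : ℕ → A.α) : Trm S → A.α
  | .var n => v n
  | .app f t => A.op f fun i => Trm.eval A v (t i)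

/-- Substitution (an endomorphism of the term algebra). -/
def Trm.subst (σ : ℕ → Trm S) : Trm S → Trm S
  | .var n => σ n
  | .app f t => .app f fun i => Trm.subst σ (t i)

/-- All variables occurring in the term are `< n`. -/
def Trm.varsLT (n : ℕ) : Trm S → Prop
  | .var m => m < n
  | .app _ t => ∀ i, Trm.varsLT n (t i)

/-- The absolutely free term algebra `Fm`. -/
def TrmAlg (S : AlgSig.{u}) : AlgStr S :=
  ⟨Trm S, Trm.app⟩

/-- A congruence of an algebra. -/
def IsCong (A : AlgStr S) (θ : A.α → A.α → Prop) : Prop :=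
  Equivalence θ ∧
    ∀ (f : S.F) (x y : Fin (S.ar f) → A.α), (∀ i, θ (x i) (y i)) → θ (A.op f x) (A.op f y)

/-- A relation is compatible with a subset `F`. -/
def CompatWith {β : Type u} (θ : β → β → Prop) (F : Set β) : Prop :=
  ∀ a b, θ a b → a ∈ F → b ∈ F

/-- The Leibniz congruence `Ω^A F`: the largest congruence of `A` compatible with `F`
(the union of all congruences compatible with `F`). -/
def Leibniz (A : AlgStr S) (F : Set A.α) : A.α → A.α → Prop :=
  fun a b => ∃ θ, IsCong A θ ∧ CompatWith θ F ∧ θ a b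

/-- A matrix `⟨A, F⟩` is reduced if its Leibniz congruence is the identity relation. -/
def IsReducedMatrix (A : AlgStr S) (F : Set A.α) : Prop :=
  ∀ a b, Leibniz A F a b ↔ a = b

/-- A logic: a structural closure operator on sets of formulas. -/
structure Logic (S : AlgSig.{u}) where
  C : Set (Trm S) → Set (Trm S)
  monotone : ∀ ⦃Γ Δ : Set (Trm S)⦄, Γ ⊆ Δ → C Γ ⊆ C Δ
  extensive : ∀ Γ, Γ ⊆ C Γ
  idem : ∀ Γ, C (C Γ) ⊆ C Γ
  structural : ∀ (σ : ℕ → Trm S) (Γ : Set (Trm S)),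
    Trm.subst σ '' C Γ ⊆ C (Trm.subst σ '' Γ)

/-- Deductive filter of a logic over an algebra. -/
def IsDedFilter (Lo : Logic S) (A : AlgStr S) (Fl : Set A.α) : Prop :=
  ∀ (Γ : Set (Trm S)) (φ : Trm S), φ ∈ Lo.C Γ →
    ∀ v : ℕ → A.α, (∀ γ ∈ Γ, Trm.eval A v γ ∈ Fl) → Trm.eval A v φ ∈ Fl

/-- Theories of a logic: the deductive filters over the term algebra. -/
def Theories (Lo : Logic S) : Set (Set (Trm S)) :=
  {Γ | IsDedFilter Lo (TrmAlg S) Γ}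

/-- The deductive filter generated by a set. -/
def FgFilter (Lo : Logic S) (A : AlgStr S) (X : Set A.α) : Set A.α :=
  {a | ∀ G, IsDedFilter Lo A G → X ⊆ G → a ∈ G}

/-- The Suszko congruence of `F` relative to a logic: the intersection of the Leibniz
congruences of all deductive filters extending `F`. -/
def Suszko (Lo : Logic S) (A : AlgStr S) (F : Set A.α) : A.α → A.α → Prop :=
  fun a b => ∀ G, IsDedFilter Lo A G → F ⊆ G → Leibniz A G a b

/-- Unary polynomial functions of an algebra. -/
def IsUnaryPoly (A : AlgStr S) (p : A.α → A.α) : Prop :=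
  ∃ (φ : Trm S) (v : ℕ → A.α), ∀ a, p a = Trm.eval A (Function.update v 0 a) φ

/-- The set of solutions `τ(A)` of a parametrized equational translation `τ(x, ȳ)`,
where the distinguished variable `x` is variable `0` and the parameters are bound by a
universal quantifier. -/
def solSet (A : AlgStr S) (τ : Set (Trm S × Trm S)) : Set A.α :=
  {a | ∀ (v : ℕ → A.α), ∀ e ∈ τ,
    Trm.eval A (Function.update v 0 a) e.1 = Trm.eval A (Function.update v 0 a) e.2}

/-- `τ` defines truth in `Mod* L`. -/
def DefinesTruth (Lo : Logic S) (τ : Set (Trm S × Trm S)) : Prop :=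
  ∀ (A : AlgStr S) (F : Set A.α), IsDedFilter Lo A F → IsReducedMatrix A F →
    solSet A τ = F

/-- `τ` almost defines truth in `Mod* L` (i.e. on its non-almost-trivial members). -/
def AlmostDefinesTruth (Lo : Logic S) (τ : Set (Trm S × Trm S)) : Prop :=
  ∀ (A : AlgStr S) (F : Set A.α), IsDedFilter Lo A F → IsReducedMatrix A F →
    F.Nonempty → solSet A τ = F

/-- Only the distinguished variable `x` (variable `0`) occurs: no parameters. -/
def Trm.noParams : Trm S → Prop
  | .var n => n = 0
  | .app _ t => ∀ i, Trm.noParams (t i)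

/-- An equational translation: a set of equations in the single variable `x`. -/
def IsEqTranslation (τ : Set (Trm S × Trm S)) : Prop :=
  ∀ e ∈ τ, Trm.noParams e.1 ∧ Trm.noParams e.2

/-- The quotient of an algebra by a relation (intended: by a congruence). -/
noncomputable def quotAlg (A : AlgStr S) (r : A.α → A.α → Prop) : AlgStr S :=
  ⟨Quot r, fun f x => Quot.mk r (A.op f fun i => (x i).out)⟩
variable {S : AlgSig.{u}}

/-- Homomorphisms between algebras of the same signature. -/
structure AlgHomS (A B : AlgStr S) where
  toFun : A.α → B.α
  map_op : ∀ (f : S.F) (x : Fin (S.ar f) → A.α),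
    toFun (A.op f x) = B.op f fun i => toFun (x i)

/-- The Leibniz operator is completely order-reflecting on a family `X` of subsets. -/
def ComplOrderReflOn (A : AlgStr S) (X : Set (Set A.α)) : Prop :=
  ∀ (Fam : Set (Set A.α)) (G : Set A.α), Fam ⊆ X → G ∈ X →
    (∀ a b, (∀ F ∈ Fam, Leibniz A F a b) → Leibniz A G a b) → ⋂₀ Fam ⊆ G

/-- A Fregean logic: every Frege relation `Λ_L Γ` is a congruence of the term algebra. -/
def Fregean (Lo : Logic S) : Prop :=
  ∀ Γ : Set (Trm S),
    IsCong (TrmAlg S) fun φ ψ => ψ ∈ Lo.C (Γ ∪ {φ}) ∧ φ ∈ Lo.C (Γ ∪ {ψ})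

/-- A protoalgebraic logic: there is a set `Δ(x,y)` of formulas in two variables with
`∅ ⊢ Δ(x,x)` and `{x} ∪ Δ(x,y) ⊢ y`. -/
def Protoalgebraic (Lo : Logic S) : Prop :=
  ∃ Δ : Set (Trm S), (∀ d ∈ Δ, Trm.varsLT 2 d) ∧
    (∀ d ∈ Δ, Trm.subst (fun _ => Trm.var 0) d ∈ Lo.C ∅) ∧
    Trm.var 1 ∈ Lo.C ({Trm.var 0} ∪ Δ)

/-- The binary term `a ∧ b` built from a binary function symbol `m`. -/
def binT (m : S.F) (hm : S.ar m = 2) (a b : Trm S) : Trm S :=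
  Trm.app m fun i => ![a, b] (Fin.cast hm i)

/-- The binary operation of an algebra induced by a binary function symbol `m`. -/
def binA (A : AlgStr S) (m : S.F) (hm : S.ar m = 2) (a b : A.α) : A.α :=
  A.op m fun i => ![a, b] (Fin.cast hm i)

/-- A subuniverse (universe of a subalgebra). -/
def Subuniv (A : AlgStr S) (B : Set A.α) : Prop :=
  ∀ (f : S.F) (x : Fin (S.ar f) → A.α), (∀ i, x i ∈ B) → A.op f x ∈ B

/-- The subuniverse generated by a set. -/
def Sg (A : AlgStr S) (X : Set A.α) : Set A.α :=
  ⋂₀ {B | Subuniv A B ∧ X ⊆ B}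

/-- A subuniverse is `κ`-generated if it is generated by a subset of cardinality `≤ κ`. -/
def KGenerated (A : AlgStr S) (κ : Cardinal.{u}) (B : Set A.α) : Prop :=
  ∃ X : Set A.α, Cardinal.mk X ≤ κ ∧ Sg A X = B

/-- The subalgebra with universe a given subuniverse. -/
def subAlg (A : AlgStr S) (B : Set A.α) (hB : Subuniv A B) : AlgStr S :=
  ⟨B, fun f x => ⟨A.op f fun i => (x i).1, hB f _ fun i => (x i).2⟩⟩

/-- The signature expanded with a single new constant symbol `1`. -/
def expSig (S : AlgSig.{u}) : AlgSig.{u} :=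
  ⟨S.F ⊕ PUnit, Sum.elim S.ar fun _ => 0⟩

/-- The inclusion of the original terms into the terms of the expanded signature. -/
def Trm.incl : Trm S → Trm (expSig S)
  | .var n => .var n
  | .app f t => .app (Sum.inl f) fun i => Trm.incl (t i)

/-! Helper material for the proof. -/

def trmToW : Trm S → WType (fun x : ℕ ⊕ S.F => Fin (Sum.elim (fun _ => 0) S.ar x))
  | .var n => .mk (Sum.inl n) (fun i => Fin.elim0 i)
  | .app f t => .mk (Sum.inr f) (fun i => trmToW (t i))

theorem trmToW_injective : Function.Injective (trmToW (S := S)) := by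
  intro s
  induction s with
  | var n =>
    intro t h
    cases t with
    | var m => simp only [trmToW, WType.mk.injEq, Sum.inl.injEq] at h; rw [h.1]
    | app g t => simp only [trmToW] at h; injection h with h1 h2; cases h1
  | app f s ih =>
    intro t h
    cases t with
    | var m => simp only [trmToW] at h; injection h with h1 h2; cases h1
    | app g t =>
      simp only [trmToW, WType.mk.injEq, Sum.inr.injEq] at h
      obtain ⟨h1, h2⟩ := h
      subst h1
      have h3 := eq_of_heq h2
      congr 1
      funext i
      exact ih i (congrFun h3 i)

theorem trm_countable (h : Countable S.F) : Countable (Trm S) := by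
  haveI : Encodable S.F := Encodable.ofCountable _
  exact (trmToW_injective (S := S)).countable

/-- `a` and `b` are separated by `F` through translations with parameters in `B`. -/
inductive SepBy (A : AlgStr S) (F B : Set A.α) : A.α → A.α → Prop
  | base (a b : A.α) : ¬ (a ∈ F ↔ b ∈ F) → SepBy A F B a b
  | step (a b : A.α) (f : S.F) (i : Fin (S.ar f)) (x : Fin (S.ar f) → A.α) :
      (∀ j, x j ∈ B) →
      SepBy A F B (A.op f (Function.update x i a)) (A.op f (Function.update x i b)) →
      SepBy A F B a b

theorem SepBy.mono {A : AlgStr S} {F B B' : Set A.α} (h : B ⊆ B') {a b : A.α}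
    (hs : SepBy A F B a b) : SepBy A F B' a b := by
  induction hs with
  | base a b hab => exact .base a b hab
  | step a b f i x hx _ ih => exact .step a b f i x (fun j => h (hx j)) ih

theorem SepBy.irrefl {A : AlgStr S} {F B : Set A.α} {a b : A.α}
    (hs : SepBy A F B a b) : a ≠ b := by
  induction hs with
  | base a b hab => rintro rfl; exact hab Iff.rfl
  | step a b f i x hx _ ih => rintro rfl; exact ih rfl

theorem SepBy.symm {A : AlgStr S} {F B : Set A.α} {a b : A.α}
    (hs : SepBy A F B a b) : SepBy A F B b a := by
  induction hs with
  | base a b hab => exact .base b a (fun h => hab h.symm)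
  | step a b f i x hx _ ih => exact .step b a f i x hx ih

theorem SepBy.cotrans {A : AlgStr S} {F B : Set A.α} {a c : A.α}
    (hs : SepBy A F B a c) : ∀ b, SepBy A F B a b ∨ SepBy A F B b c := by
  induction hs with
  | base a c hac =>
    intro b
    by_cases h : a ∈ F ↔ b ∈ F
    · exact Or.inr (.base b c (fun h' => hac (h.trans h')))
    · exact Or.inl (.base a b h)
  | step a c f i x hx _ ih =>
    intro b
    rcases ih (A.op f (Function.update x i b)) with h | h
    · exact Or.inl (.step a b f i x hx h)
    · exact Or.inr (.step b c f i x hx h)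

theorem SepBy.countable_witness {A : AlgStr S} {F B : Set A.α} {a b : A.α}
    (hs : SepBy A F B a b) : ∃ B' : Set A.α, B'.Countable ∧ SepBy A F B' a b := by
  induction hs with
  | base a b hab => exact ⟨∅, Set.countable_empty, .base a b hab⟩
  | step a b f i x hx _ ih =>
    obtain ⟨B', hB', h⟩ := ih
    exact ⟨B' ∪ Set.range x, hB'.union (Set.countable_range x),
      .step a b f i x (fun j => Or.inr ⟨j, rfl⟩) (h.mono Set.subset_union_left)⟩

theorem leibniz_of_not_sepBy {A : AlgStr S} {F : Set A.α} {a b : A.α}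
    (h : ¬ SepBy A F Set.univ a b) : Leibniz A F a b := by
  refine ⟨fun a b => ¬ SepBy A F Set.univ a b, ⟨⟨?_, ?_, ?_⟩, ?_⟩, ?_, h⟩
  · intro x hx
    exact hx.irrefl rfl
  · intro x y hxy hyx
    exact hxy hyx.symm
  · intro x y z hxy hyz hxz
    rcases hxz.cotrans y with h | h
    · exact hxy h
    · exact hyz h
  · intro f x y hxy
    have key : ∀ s : Finset (Fin (S.ar f)),
        ¬ SepBy A F Set.univ (A.op f x) (A.op f (fun i => if i ∈ s then y i else x i)) := by
      intro s
      induction s using Finset.induction_on with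
      | empty => intro hs; exact hs.irrefl (by simp)
      | insert j s hj ih =>
        intro hs
        rcases hs.cotrans (A.op f (fun i => if i ∈ s then y i else x i)) with h | h
        · exact ih h
        · apply hxy j
          refine .step _ _ f j (fun i => if i ∈ s then y i else x i) (fun _ => trivial) ?_
          convert h using 2
          · funext i
            by_cases hi : i = j
            · subst hi; simp [hj]
            · simp [Function.update_of_ne hi]
          · funext i
            by_cases hi : i = j
            · subst hi; simp
            · simp [Function.update_of_ne hi, hi]
    simpa using key Finset.univ
  · intro a b hab ha
    by_contra hb
    exact hab (.base a b (fun h => hb (h.1 ha)))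

/-- Signature with countably many new binary symbols. -/
def skSig (S : AlgSig.{u}) : AlgSig.{u} :=
  ⟨S.F ⊕ ULift.{u} ℕ, Sum.elim S.ar fun _ => 2⟩

def skAlg (A : AlgStr S) (w : A.α → A.α → ℕ → A.α) : AlgStr (skSig S) :=
  ⟨A.α, fun f => match f with
    | Sum.inl f => fun x => A.op f x
    | Sum.inr n => fun x => w (x (0 : Fin 2)) (x (1 : Fin 2)) n.down⟩

theorem exists_closed (hcount : Countable S.F) (A : AlgStr S) (F : Set A.α) (a0 g0 : A.α) :
    ∃ B : Set A.α, B.Countable ∧ a0 ∈ B ∧ g0 ∈ B ∧ Subuniv A B ∧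
      ∀ a ∈ B, ∀ b ∈ B, SepBy A F Set.univ a b → SepBy A F B a b := by
  have hw : ∀ a b : A.α, ∃ w : ℕ → A.α,
      SepBy A F Set.univ a b → SepBy A F (Set.range w) a b := by
    intro a b
    by_cases h : SepBy A F Set.univ a b
    · obtain ⟨B', hB', h'⟩ := h.countable_witness
      obtain ⟨w, hw⟩ := (hB'.insert a0).exists_eq_range (Set.insert_nonempty _ _)
      exact ⟨w, fun _ => hw ▸ h'.mono (Set.subset_insert _ _)⟩
    · exact ⟨fun _ => a, fun h' => absurd h' h⟩
  choose w hw using hw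
  haveI : Countable (skSig S).F := inferInstanceAs (Countable (S.F ⊕ ULift.{u} ℕ))
  haveI := trm_countable (S := skSig S) inferInstance
  let v0 : ℕ → (skAlg A w).α := fun n => if n = 0 then a0 else g0
  refine ⟨Set.range (Trm.eval (skAlg A w) v0), Set.countable_range _, ⟨.var 0, ?_⟩,
    ⟨.var 1, ?_⟩, ?_, ?_⟩
  · simp [Trm.eval, v0]
  · simp [Trm.eval, v0]
  · intro f x hx
    choose t ht using hx
    refine ⟨Trm.app (S := skSig S) (Sum.inl f) t, ?_⟩
    simp only [Trm.eval]
    change A.op f _ = A.op f x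
    congr 1
    funext i
    exact ht i
  · rintro a ⟨s, rfl⟩ b ⟨t, rfl⟩ h
    refine (hw _ _ h).mono ?_
    rintro _ ⟨n, rfl⟩
    exact ⟨Trm.app (S := skSig S) (Sum.inr ⟨n⟩) (![s, t] : Fin 2 → Trm (skSig S)), rfl⟩

theorem eval_eval (A : AlgStr S) (v : ℕ → A.α) (w : ℕ → Trm S) (φ : Trm S) :
    Trm.eval A v (Trm.eval (TrmAlg S) w φ) = Trm.eval A (fun n => Trm.eval A v (w n)) φ := by
  induction φ with
  | var n => rfl
  | app f t ih =>
    change A.op f _ = A.op f _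
    congr 1
    funext i
    exact ih i

theorem theory_preimage {Lo : Logic S} {A : AlgStr S} {F : Set A.α} (hF : IsDedFilter Lo A F)
    (v : ℕ → A.α) : (Trm.eval A v ⁻¹' F) ∈ Theories Lo := by
  intro Γ φ hφ w hw
  change Trm.eval A v (Trm.eval (TrmAlg S) w φ) ∈ F
  refine (congrArg (· ∈ F) (eval_eval A v w φ)).mpr (hF Γ φ hφ _ fun γ hγ => ?_)
  exact (congrArg (· ∈ F) (eval_eval A v w γ)).mp (hw γ hγ)

theorem leibniz_preimage {A : AlgStr S} {G : Set A.α} (v : ℕ → A.α) {s t : Trm S}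
    (h : Leibniz A G (Trm.eval A v s) (Trm.eval A v t)) :
    Leibniz (TrmAlg S) (Trm.eval A v ⁻¹' G) s t := by
  obtain ⟨θ, ⟨he, hc⟩, hG, hst⟩ := h
  refine ⟨fun s t => θ (Trm.eval A v s) (Trm.eval A v t), ⟨⟨?_, ?_, ?_⟩, ?_⟩, ?_, hst⟩
  · intro x; exact he.refl _
  · intro x y h; exact he.symm h
  · intro x y z h h'; exact he.trans h h'
  · intro f x y h; exact hc f _ _ h
  · intro a b h ha; exact hG _ _ h ha

theorem not_sepBy_of_leibniz {A : AlgStr S} {F : Set A.α} (v : ℕ → A.α) {a b : A.α}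
    (h : SepBy A F (Set.range (Trm.eval A v)) a b) : ∀ s t : Trm S,
    Trm.eval A v s = a → Trm.eval A v t = b →
    ¬ Leibniz (TrmAlg S) (Trm.eval A v ⁻¹' F) s t := by
  induction h with
  | base a b hab =>
    rintro s t rfl rfl ⟨θ, ⟨he, hc⟩, hF, hst⟩
    exact hab ⟨hF s t hst, hF t s (he.symm hst)⟩
  | step a b f i x hx _ ih =>
    rintro s t rfl rfl ⟨θ, ⟨he, hc⟩, hF, hst⟩
    choose y hy using hx
    have hev : ∀ s : Trm S, Trm.eval A v (Trm.app f (Function.update y i s)) =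
        A.op f (Function.update x i (Trm.eval A v s)) := by
      intro s
      simp only [Trm.eval]
      congr 1
      funext j
      by_cases hj : j = i
      · subst hj; simp
      · simp [Function.update_of_ne hj, hy]
    refine ih _ _ (hev s) (hev t) ⟨θ, ⟨he, hc⟩, hF, ?_⟩
    refine hc f _ _ fun j => ?_
    by_cases hj : j = i
    · subst hj; simpa using hst
    · simp only [Function.update_of_ne hj]; exact he.refl _

theorem transfer_core (hcount : Countable S.F) (A : AlgStr S) (F G : Set A.α)
    (hFG : ∀ a b, Leibniz A F a b → Leibniz A G a b) (a0 g0 : A.α) :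
    ∃ v : ℕ → A.α, (∃ n, v n = a0) ∧ (∃ n, v n = g0) ∧
      ∀ s t, Leibniz (TrmAlg S) (Trm.eval A v ⁻¹' F) s t →
        Leibniz (TrmAlg S) (Trm.eval A v ⁻¹' G) s t := by
  obtain ⟨B, hB, ha, hg, hsub, hsep⟩ := exists_closed hcount A F a0 g0
  obtain ⟨v, rfl⟩ := hB.exists_eq_range ⟨a0, ha⟩
  have hmem : ∀ s : Trm S, Trm.eval A v s ∈ Set.range v := by
    intro s
    induction s with
    | var n => exact ⟨n, rfl⟩
    | app f t ih => exact hsub f _ ih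
  refine ⟨v, ha, hg, fun s t h => leibniz_preimage v (hFG _ _ (leibniz_of_not_sepBy fun hs => ?_))⟩
  refine not_sepBy_of_leibniz v ((hsep _ (hmem s) _ (hmem t) hs).mono ?_) s t rfl rfl h
  rintro _ ⟨n, rfl⟩
  exact ⟨.var n, rfl⟩

/-- for a logic in a countable language, the (almost) order-reflection of
the Leibniz operator transfers from the theories to the deductive filters over every
algebra. -/
theorem countable_orderReflection_transfer {S : AlgSig.{u}} (hcount : Countable S.F)
    (Lo : Logic S) :
    ((∀ Γ Γ' : Set (Trm S), Γ ∈ Theories Lo → Γ' ∈ Theories Lo →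
        (∀ a b, Leibniz (TrmAlg S) Γ a b → Leibniz (TrmAlg S) Γ' a b) → Γ ⊆ Γ') →
      ∀ (A : AlgStr S) (F G : Set A.α), IsDedFilter Lo A F → IsDedFilter Lo A G →
        (∀ a b, Leibniz A F a b → Leibniz A G a b) → F ⊆ G) ∧
    ((∀ Γ Γ' : Set (Trm S), Γ ∈ Theories Lo → Γ.Nonempty →
        Γ' ∈ Theories Lo → Γ'.Nonempty →
        (∀ a b, Leibniz (TrmAlg S) Γ a b → Leibniz (TrmAlg S) Γ' a b) → Γ ⊆ Γ') →
      ∀ (A : AlgStr S) (F G : Set A.α),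
        IsDedFilter Lo A F → F.Nonempty → IsDedFilter Lo A G → G.Nonempty →
        (∀ a b, Leibniz A F a b → Leibniz A G a b) → F ⊆ G) := by
  constructor
  · intro H A F G hF hG hFG a ha
    obtain ⟨v, ⟨n, hn⟩, -, hv⟩ := transfer_core hcount A F G hFG a a
    have h := H _ _ (theory_preimage hF v) (theory_preimage hG v) hv
    have h1 : Trm.eval A v (.var n) ∈ G := h (show v n ∈ F from hn ▸ ha)
    exact hn ▸ h1
  · intro H A F G hF _ hG hGne hFG a ha
    obtain ⟨g, hg⟩ := hGne
    obtain ⟨v, ⟨n, hn⟩, ⟨m, hm⟩, hv⟩ := transfer_core hcount A F G hFG a g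
    have h0 : Trm.eval A v (.var n) ∈ F := show v n ∈ F from hn ▸ ha
    have h0' : Trm.eval A v (.var m) ∈ G := show v m ∈ G from hm ▸ hg
    have h := H _ _ (theory_preimage hF v) ⟨_, h0⟩ (theory_preimage hG v) ⟨_, h0'⟩ hv
    have h1 : Trm.eval A v (.var n) ∈ G := h h0
    exact hn ▸ h1
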